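/- Let m = (m₁,…,m_k) be positive integers, t ∈ ℂ, ℓ ≥ 1 an integer, and let μ ∈ ℂ^k have pairwise distinct coordinates. Then the limit as ω → 0 (ω ∈ ℂ, ω ≠ 0) of Σ_{j=1}^{k} μ_j^ℓ · C̃_j(m, μ + (t/ω)·(1,…,1), ω) exists and equals θ_ℓ(m,μ,t) = Σ_{s=1}^{k} t^{s−1} · Σ_{1≤j₁<…<j_s≤k} m_{j₁}·…·m_{j_s} · Σ μ_{j₁}^{d₁}·…·μ_{j_s}^{d_s}, where the innermost sum ranges over all s-tuples (d₁,…,d_s) of nonnegative integers with d₁+…+d_s = ℓ+1−s. -/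

import Mathlib

noncomputable section

/-- `θ̃_ℓ(ν,μ,ω)`: the inner sum ranges over tuples of *positive* integers summing to `ℓ`. -/
def thetaT {k : ℕ} (ν μ : Fin k → ℂ) (ω : ℂ) (ℓ : ℕ) : ℂ :=
  ∑ s ∈ Finset.Icc 1 k,
    ω ^ (s - 1) *
      ∑ J ∈ Finset.powersetCard s (Finset.univ : Finset (Fin k)),
        (∏ j ∈ J, ν j) *
          ∑ d ∈ (J.finsuppAntidiag ℓ).filter (fun d => ∀ j ∈ J, 1 ≤ d j),
            ∏ j ∈ J, μ j ^ d j

/-- `C̃_j(ν,μ,ω)` (for `μ` with pairwise distinct coordinates). -/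
def Ctil {k : ℕ} (ν μ : Fin k → ℂ) (ω : ℂ) (j : Fin k) : ℂ :=
  ν j + ν j *
    ∑ p ∈ Finset.Icc 1 (k - 1),
      ω ^ p *
        ∑ I ∈ Finset.powersetCard p (Finset.univ.erase j),
          ∏ i ∈ I, (ν i * μ i / (μ j - μ i))

/-- `θ_ℓ(m,μ,t)`: the inner sum ranges over tuples of *nonnegative* integers summing
to `ℓ+1−s`. -/
def theta {k : ℕ} (m : Fin k → ℕ) (μ : Fin k → ℂ) (t : ℂ) (ℓ : ℕ) : ℂ :=
  ∑ s ∈ Finset.Icc 1 k,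
    if s ≤ ℓ + 1 then
      t ^ (s - 1) *
        ∑ J ∈ Finset.powersetCard s (Finset.univ : Finset (Fin k)),
          (∏ j ∈ J, (m j : ℂ)) *
            ∑ d ∈ J.finsuppAntidiag (ℓ + 1 - s), ∏ j ∈ J, μ j ^ d j
    else 0

open Finset PowerSeries in
/-- The generating series `∏_{j ∈ J} X / (1 - x_j X)`, whose coefficients are the shifted complete
homogeneous symmetric polynomials in `x_j`, `j ∈ J`. -/
def shiftedGeomProd {ι K : Type*} [Field K] (x : ι → K) (J : Finset ι) : PowerSeries K :=
  ∏ j ∈ J, (X * PowerSeries.mk fun n => x j ^ n)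

/-- The divided difference of `z ↦ z ^ ℓ` at the nodes `x_j`, `j ∈ J`. -/
def powDividedDiff {ι K : Type*} [Field K] [DecidableEq ι] (x : ι → K) (J : Finset ι) (ℓ : ℕ) : K :=
  ∑ j ∈ J, x j ^ ℓ * ∏ i ∈ J.erase j, (x j - x i)⁻¹

section DividedDifferences

open Finset

variable {ι K : Type*} [Field K] (x : ι → K)

lemma geom_mul_one_sub (a : K) :
    (PowerSeries.mk fun n => a ^ n) * (1 - PowerSeries.C a * PowerSeries.X) = 1 := by
  ext n
  rw [mul_sub, mul_one, ← mul_assoc, map_sub]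
  cases n with
  | zero => simp
  | succ n =>
    rw [PowerSeries.coeff_succ_mul_X, PowerSeries.coeff_mul_C]
    simp [PowerSeries.coeff_one, pow_succ]

lemma coeff_shiftedGeomProd [DecidableEq ι] (J : Finset ι) (n : ℕ) :
    PowerSeries.coeff n (shiftedGeomProd x J) =
      if #J ≤ n then ∑ d ∈ J.finsuppAntidiag (n - #J), ∏ j ∈ J, x j ^ d j else 0 := by
  rw [shiftedGeomProd, prod_mul_distrib, prod_const, PowerSeries.coeff_X_pow_mul']
  simp [PowerSeries.coeff_prod]

variable [DecidableEq ι]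

lemma coeff_shiftedGeomProd_succ {J : Finset ι} {a : ι} (ha : a ∈ J) (n : ℕ) :
    PowerSeries.coeff (n + 1) (shiftedGeomProd x J) =
      x a * PowerSeries.coeff n (shiftedGeomProd x J) +
        PowerSeries.coeff n (shiftedGeomProd x (J.erase a)) := by
  have h : shiftedGeomProd x J * (1 - PowerSeries.C (x a) * PowerSeries.X) =
      shiftedGeomProd x (J.erase a) * PowerSeries.X := by
    rw [shiftedGeomProd, ← mul_prod_erase _ _ ha, shiftedGeomProd]
    linear_combination (PowerSeries.X * ∏ j ∈ J.erase a,
      (PowerSeries.X * PowerSeries.mk fun n => x j ^ n)) * geom_mul_one_sub (x a)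
  have h' := congrArg (PowerSeries.coeff (n + 1)) h
  rw [mul_sub, mul_one, ← mul_assoc, map_sub, PowerSeries.coeff_succ_mul_X,
    PowerSeries.coeff_succ_mul_X, PowerSeries.coeff_mul_C] at h'
  linear_combination h'

variable {x}

lemma powDividedDiff_succ (hx : Function.Injective x) {J : Finset ι} {a : ι} (ha : a ∈ J) (ℓ : ℕ) :
    powDividedDiff x J (ℓ + 1) =
      x a * powDividedDiff x J ℓ + powDividedDiff x (J.erase a) ℓ := by
  rw [← sub_eq_iff_eq_add']
  simp only [powDividedDiff]
  rw [mul_sum, ← sum_sub_distrib, ← add_sum_erase _ _ ha]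
  have h0 : x a ^ (ℓ + 1) * ∏ i ∈ J.erase a, (x a - x i)⁻¹ -
      x a * (x a ^ ℓ * ∏ i ∈ J.erase a, (x a - x i)⁻¹) = 0 := by ring
  rw [h0, zero_add]
  refine sum_congr rfl fun j hj => ?_
  have hja : j ≠ a := ne_of_mem_erase hj
  have hmem : a ∈ J.erase j := mem_erase.2 ⟨hja.symm, ha⟩
  rw [← mul_prod_erase _ _ hmem, erase_right_comm]
  have hne : x j - x a ≠ 0 := sub_ne_zero.2 (hx.ne hja)
  field_simp
  ring

lemma powDividedDiff_eq_coeff (hx : Function.Injective x) (J : Finset ι) (ℓ : ℕ) :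
    powDividedDiff x J ℓ = PowerSeries.coeff (ℓ + 1) (shiftedGeomProd x J) := by
  induction J using Finset.strongInduction generalizing ℓ with
  | H J ih =>
    rcases J.eq_empty_or_nonempty with rfl | ⟨a, ha⟩
    · simp [powDividedDiff, shiftedGeomProd, PowerSeries.coeff_one]
    rcases (J.erase a).eq_empty_or_nonempty with hJ | ⟨b, hb⟩
    · obtain rfl : J = {a} := by
        rw [← insert_erase ha, hJ]; rfl
      simp [powDividedDiff, shiftedGeomProd, PowerSeries.coeff_succ_X_mul]
    obtain ⟨hba, hb⟩ := mem_erase.1 hb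
    have hne : x a - x b ≠ 0 := sub_ne_zero.2 (hx.ne hba.symm)
    apply mul_left_cancel₀ hne
    linear_combination ih _ (erase_ssubset hb) ℓ - ih _ (erase_ssubset ha) ℓ
      - powDividedDiff_succ hx ha ℓ + powDividedDiff_succ hx hb ℓ
      + coeff_shiftedGeomProd_succ x ha (ℓ + 1) - coeff_shiftedGeomProd_succ x hb (ℓ + 1)

end DividedDifferences

open Finset in
lemma sum_powersetCard_erase {ι M : Type*} [DecidableEq ι] [AddCommMonoid M] (s : Finset ι)
    (p : ℕ) (f : ι → Finset ι → M) :
    ∑ j ∈ s, ∑ I ∈ powersetCard p (s.erase j), f j I =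
      ∑ J ∈ powersetCard (p + 1) s, ∑ j ∈ J, f j (J.erase j) := by
  rw [sum_sigma', sum_sigma']
  refine sum_bij' (fun q _ => ⟨insert q.1 q.2, q.1⟩) (fun q _ => ⟨q.2, q.1.erase q.2⟩) ?_ ?_ ?_ ?_ ?_
  · rintro ⟨j, I⟩ h
    simp only [mem_sigma, mem_powersetCard, subset_erase] at h ⊢
    obtain ⟨hj, ⟨hI, hjI⟩, hc⟩ := h
    exact ⟨⟨insert_subset hj hI, by rw [card_insert_of_notMem hjI, hc]⟩, mem_insert_self _ _⟩
  · rintro ⟨J, j⟩ h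
    simp only [mem_sigma, mem_powersetCard] at h ⊢
    obtain ⟨⟨hJ, hc⟩, hj⟩ := h
    exact ⟨hJ hj, erase_subset_erase _ hJ, by rw [card_erase_of_mem hj, hc]; rfl⟩
  · rintro ⟨j, I⟩ h
    simp only [mem_sigma, mem_powersetCard, subset_erase] at h
    simp [erase_insert h.2.1.2]
  · rintro ⟨J, j⟩ h
    simp only [mem_sigma] at h
    simp [insert_erase h.2]
  · rintro ⟨j, I⟩ h
    simp only [mem_sigma, mem_powersetCard, subset_erase] at h
    simp [erase_insert h.2.1.2]

open Finset in
/-- For `ω ≠ 0` the poles of the shift `t / ω` are absorbed by the powers of `ω`. -/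
lemma Ctil_shift {k : ℕ} (hk : 1 ≤ k) (ν μ : Fin k → ℂ) (t : ℂ) {ω : ℂ} (hω : ω ≠ 0) (j : Fin k) :
    Ctil ν (fun i => μ i + t / ω) ω j =
      ∑ p ∈ range k, ∑ I ∈ powersetCard p (univ.erase j),
        ν j * ∏ i ∈ I, (ν i * (ω * μ i + t) * (μ j - μ i)⁻¹) := by
  obtain ⟨n, rfl⟩ : ∃ n, k = n + 1 := ⟨k - 1, by omega⟩
  rw [Ctil, sum_range_succ', add_comm]
  congr 1
  · rw [mul_sum, Nat.add_sub_cancel, range_eq_Ico,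
      sum_Ico_add' (fun p => ∑ I ∈ powersetCard p (univ.erase j),
        ν j * ∏ i ∈ I, (ν i * (ω * μ i + t) * (μ j - μ i)⁻¹)) 0 n 1]
    refine sum_congr (by ext; simp) fun p _ => ?_
    rw [mul_sum, mul_sum]
    refine sum_congr rfl fun I hI => ?_
    rw [← (mem_powersetCard.1 hI).2, ← prod_const, ← prod_mul_distrib]
    congr 1
    refine prod_congr rfl fun i _ => ?_
    rw [add_sub_add_right_eq_sub, div_eq_mul_inv]
    field_simp
  · simp

open Finset in
lemma theta_eq_sum {k : ℕ} (m : Fin k → ℕ) {μ : Fin k → ℂ} (hμ : Function.Injective μ) (t : ℂ)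
    (ℓ : ℕ) :
    theta m μ t ℓ = ∑ j, μ j ^ ℓ * ∑ p ∈ range k, ∑ I ∈ powersetCard p (univ.erase j),
        (m j : ℂ) * ∏ i ∈ I, ((m i : ℂ) * t * (μ j - μ i)⁻¹) := by
  simp only [mul_sum]
  rw [sum_comm]
  simp only [sum_powersetCard_erase]
  rw [range_eq_Ico, sum_Ico_add' (fun s => ∑ J ∈ powersetCard s univ, ∑ j ∈ J,
    μ j ^ ℓ * ((m j : ℂ) * ∏ i ∈ J.erase j, ((m i : ℂ) * t * (μ j - μ i)⁻¹))) 0 k 1, theta]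
  refine sum_congr (by ext; simp) fun s _ => ?_
  have h : ∀ J ∈ powersetCard s (univ : Finset (Fin k)), ∑ j ∈ J,
      μ j ^ ℓ * ((m j : ℂ) * ∏ i ∈ J.erase j, ((m i : ℂ) * t * (μ j - μ i)⁻¹)) =
      t ^ (s - 1) * ((∏ j ∈ J, (m j : ℂ)) * if s ≤ ℓ + 1 then
        ∑ d ∈ J.finsuppAntidiag (ℓ + 1 - s), ∏ j ∈ J, μ j ^ d j else 0) := by
    intro J hJ
    obtain rfl := (mem_powersetCard.1 hJ).2
    rw [← coeff_shiftedGeomProd, ← powDividedDiff_eq_coeff hμ, powDividedDiff, mul_sum, mul_sum]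
    refine sum_congr rfl fun j hj => ?_
    rw [prod_mul_distrib, prod_mul_distrib, prod_const, card_erase_of_mem hj,
      ← mul_prod_erase _ _ hj]
    ring
  rw [sum_congr rfl h]
  split_ifs
  · rw [mul_sum]
  · simp

/-- `Σ_j μ_j^ℓ C̃_j(m, μ + (t/ω)·𝟙, ω) → θ_ℓ(m,μ,t)` as `ω → 0`. -/
theorem statement17 (k : ℕ) (hk : 1 ≤ k) (m : Fin k → ℕ) (hm : ∀ i, 0 < m i)
    (t : ℂ) (ℓ : ℕ) (hℓ : 1 ≤ ℓ) (μ : Fin k → ℂ) (hμ : Function.Injective μ) :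
    Filter.Tendsto
      (fun ω : ℂ =>
        ∑ j : Fin k, μ j ^ ℓ * Ctil (fun i => (m i : ℂ)) (fun i => μ i + t / ω) ω j)
      (nhdsWithin 0 {(0 : ℂ)}ᶜ) (nhds (theta m μ t ℓ)) := by
  have hcont : Continuous fun ω : ℂ => ∑ j, μ j ^ ℓ *
      ∑ p ∈ Finset.range k, ∑ I ∈ Finset.powersetCard p (Finset.univ.erase j),
        (m j : ℂ) * ∏ i ∈ I, ((m i : ℂ) * (ω * μ i + t) * (μ j - μ i)⁻¹) := by
    fun_prop
  have hlim := (hcont.tendsto 0).mono_left (nhdsWithin_le_nhds (s := {(0 : ℂ)}ᶜ))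
  simp only [zero_mul, zero_add] at hlim
  rw [theta_eq_sum m hμ]
  refine hlim.congr' ?_
  filter_upwards [self_mem_nhdsWithin] with ω hω
  exact Finset.sum_congr rfl fun j _ => by rw [Ctil_shift hk _ _ _ hω]

end
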